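/- arXiv:2308.01049 — 4 statements merged into one kernel-verified Lean document; each statement's English description precedes it below -/
import Mathlib

section
/- Let N ≥ 2 and let a, b ∈ ℝ^N be linearly independent. Then the two real numbers (1/2)(⟨a,b⟩ + |a||b|) and (1/2)(⟨a,b⟩ − |a||b|) are eigenvalues of the symmetric matrix S = (1/2)(a ⊗ b + (a ⊗ b)ᵀ), these two numbers are distinct and nonzero (since |⟨a,b⟩| < |a||b| by strict Cauchy–Schwarz for linearly independent vectors), every eigenvalue of S lies in the set {(1/2)(⟨a,b⟩ + |a||b|), (1/2)(⟨a,b⟩ − |a||b|), 0}, and if N ≥ 3 then 0 is also an eigenvalue of S. -/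
/-- Let `N ≥ 2` and `a, b ∈ ℝ^N` linearly independent.  With
`S = (1/2)(a ⊗ b + (a ⊗ b)ᵀ)` the symmetric part of the rank-one matrix `a ⊗ b`, the two
numbers `(1/2)(⟨a,b⟩ ± |a||b|)` are eigenvalues of `S`; they are distinct and nonzero
(strict Cauchy-Schwarz); every eigenvalue of `S` lies in
`{(1/2)(⟨a,b⟩ + |a||b|), (1/2)(⟨a,b⟩ - |a||b|), 0}`; and if `N ≥ 3` then `0` is also an
eigenvalue of `S`. -/
theorem eigenvalues_symmetric_part_rank_one (N : ℕ) (hN : 2 ≤ N) (a b : Fin N → ℝ)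
    (hab : LinearIndependent ℝ ![a, b])
    (S : Matrix (Fin N) (Fin N) ℝ)
    (hS : S = (1 / 2 : ℝ) • (Matrix.vecMulVec a b + (Matrix.vecMulVec a b).transpose))
    (lamPlus lamMinus : ℝ)
    (hPlus : lamPlus = (1 / 2) * ((∑ i, a i * b i) +
      Real.sqrt (∑ i, a i ^ 2) * Real.sqrt (∑ i, b i ^ 2)))
    (hMinus : lamMinus = (1 / 2) * ((∑ i, a i * b i) -
      Real.sqrt (∑ i, a i ^ 2) * Real.sqrt (∑ i, b i ^ 2))) :
    Module.End.HasEigenvalue S.mulVecLin lamPlus ∧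
    Module.End.HasEigenvalue S.mulVecLin lamMinus ∧
    lamPlus ≠ lamMinus ∧ lamPlus ≠ 0 ∧ lamMinus ≠ 0 ∧
    (∀ μ : ℝ, Module.End.HasEigenvalue S.mulVecLin μ →
      μ ∈ ({lamPlus, lamMinus, 0} : Set ℝ)) ∧
    (3 ≤ N → Module.End.HasEigenvalue S.mulVecLin 0) := by
  have hSv : ∀ v i, S.mulVecLin v i = (1 / 2) * (a i * (∑ j, b j * v j) + b i * (∑ j, a j * v j)) := by
    intro v i
    subst hS
    simp only [Matrix.mulVecLin_apply, Matrix.mulVec, dotProduct, Matrix.smul_apply,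
      Matrix.add_apply, Matrix.transpose_apply, Matrix.vecMulVec_apply, smul_eq_mul,
      Finset.mul_sum, ← Finset.sum_add_distrib]
    exact Finset.sum_congr rfl fun j _ => by ring
  have hli : ∀ s t : ℝ, (∀ i, s * a i + t * b i = 0) → s = 0 ∧ t = 0 := by
    intro s t h
    exact (LinearIndependent.pair_iff.1 hab) s t (funext fun i => by simpa using h i)
  have hcomb : ∀ (u : Fin N → ℝ) (s t : ℝ), ∑ j, u j * (s * a j + t * b j)
      = s * (∑ j, u j * a j) + t * ∑ j, u j * b j := by
    intro u s t
    simp only [Finset.mul_sum, ← Finset.sum_add_distrib]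
    exact Finset.sum_congr rfl fun j _ => by ring
  have hpos : ∀ u : Fin N → ℝ, u ≠ 0 → 0 < ∑ i, u i ^ 2 := by
    intro u hu
    obtain ⟨i, hi⟩ := Function.ne_iff.1 hu
    have hi' : u i ≠ 0 := hi
    exact Finset.sum_pos' (fun _ _ => sq_nonneg _) ⟨i, Finset.mem_univ _, by positivity⟩
  have ha : 0 < ∑ i, a i ^ 2 := hpos a (by
    rintro rfl
    exact one_ne_zero (hli 1 0 (by simp)).1)
  have hb : 0 < ∑ i, b i ^ 2 := hpos b (by
    rintro rfl
    exact one_ne_zero (hli 0 1 (by simp)).2)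
  obtain ⟨A, hA⟩ : ∃ A, A = Real.sqrt (∑ i, a i ^ 2) := ⟨_, rfl⟩
  obtain ⟨B, hB⟩ : ∃ B, B = Real.sqrt (∑ i, b i ^ 2) := ⟨_, rfl⟩
  obtain ⟨c, hc⟩ : ∃ c, c = ∑ i, a i * b i := ⟨_, rfl⟩
  have hA0 : 0 < A := hA ▸ Real.sqrt_pos.2 ha
  have hB0 : 0 < B := hB ▸ Real.sqrt_pos.2 hb
  have haa : ∑ i, a i * a i = A ^ 2 := by
    rw [hA, Real.sq_sqrt ha.le]
    exact Finset.sum_congr rfl fun j _ => by ring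
  have hbb : ∑ i, b i * b i = B ^ 2 := by
    rw [hB, Real.sq_sqrt hb.le]
    exact Finset.sum_congr rfl fun j _ => by ring
  have hba : ∑ i, b i * a i = c := by
    rw [hc]
    exact Finset.sum_congr rfl fun j _ => by ring
  rw [← hA, ← hB, ← hc] at hPlus hMinus
  have hCS : c ^ 2 < (A * B) ^ 2 := by
    have h1 : 0 < ∑ i, (B ^ 2 * a i + (-c) * b i) ^ 2 := by
      refine hpos (fun i => B ^ 2 * a i + (-c) * b i) ?_
      intro h
      have := (hli (B ^ 2) (-c) (fun i => congrFun h i)).1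
      exact absurd this (by positivity)
    have h2 : ∑ i, (B ^ 2 * a i + (-c) * b i) ^ 2 = B ^ 2 * ((A * B) ^ 2 - c ^ 2) := by
      calc _ = ∑ i, (B ^ 2 * a i + (-c) * b i) * (B ^ 2 * a i + (-c) * b i) :=
            Finset.sum_congr rfl fun j _ => by ring
        _ = B ^ 2 * ∑ i, (B ^ 2 * a i + (-c) * b i) * a i
            + (-c) * ∑ i, (B ^ 2 * a i + (-c) * b i) * b i := hcomb _ _ _
        _ = B ^ 2 * ∑ i, a i * (B ^ 2 * a i + (-c) * b i)
            + (-c) * ∑ i, b i * (B ^ 2 * a i + (-c) * b i) := by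
            simp only [mul_comm]
        _ = _ := by
            rw [hcomb, hcomb, haa, hbb, hba, ← hc]; ring
    rw [h2] at h1
    have := (mul_pos_iff_of_pos_left (by positivity)).1 h1
    linarith
  have hAB : 0 < A * B := mul_pos hA0 hB0
  have hlt : |c| < A * B := by
    have := sq_lt_sq.1 hCS
    rwa [abs_of_pos hAB] at this
  obtain ⟨hl, hr⟩ := abs_lt.1 hlt
  have hev : ∀ e : ℝ, e ^ 2 = 1 →
      Module.End.HasEigenvalue S.mulVecLin ((1 / 2) * (c + e * (A * B))) := by
    intro e he
    refine Module.End.hasEigenvalue_of_hasEigenvector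
      (x := fun i => B * a i + (e * A) * b i) ⟨?_, ?_⟩
    · rw [Module.End.mem_eigenspace_iff]
      funext i
      rw [hSv, hcomb, hcomb, haa, hbb, hba, ← hc]
      simp only [Pi.smul_apply, smul_eq_mul]
      linear_combination (-(1 / 2) * A ^ 2 * B * b i) * he
    · intro h
      exact hB0.ne' (hli B (e * A) (fun i => congrFun h i)).1
  refine ⟨?_, ?_, ?_, ?_, ?_, ?_, ?_⟩
  · have := hev 1 (by norm_num)
    rwa [one_mul, ← hPlus] at this
  · have := hev (-1) (by norm_num)
    rwa [neg_one_mul, ← sub_eq_add_neg, ← hMinus] at this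
  · intro h; linarith
  · intro h; linarith
  · intro h; linarith
  · intro μ hμ
    obtain ⟨v, hv⟩ := hμ.exists_hasEigenvector
    have hv0 := hv.2
    have hvi : ∀ i, (1 / 2) * (a i * (∑ j, b j * v j) + b i * (∑ j, a j * v j)) = μ * v i := by
      intro i
      rw [← hSv, hv.apply_eq_smul]; rfl
    obtain ⟨x, hx⟩ : ∃ x, x = ∑ j, b j * v j := ⟨_, rfl⟩
    obtain ⟨y, hy⟩ : ∃ y, y = ∑ j, a j * v j := ⟨_, rfl⟩
    rw [← hx, ← hy] at hvi
    have key : ∀ u : Fin N → ℝ, μ * ∑ j, u j * v j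
        = (x / 2) * (∑ j, u j * a j) + (y / 2) * ∑ j, u j * b j := by
      intro u
      rw [← hcomb, Finset.mul_sum]
      exact Finset.sum_congr rfl fun j _ => by linear_combination (-u j) * hvi j
    have k1 := key a
    have k2 := key b
    rw [← hy, haa, ← hc] at k1
    rw [← hx, hbb, hba] at k2
    have f1 : ((2 * μ - c) ^ 2 - (A * B) ^ 2) * x = 0 := by
      linear_combination 2 * (2 * μ - c) * k2 + 2 * B ^ 2 * k1
    have f2 : ((2 * μ - c) ^ 2 - (A * B) ^ 2) * y = 0 := by
      linear_combination 2 * (2 * μ - c) * k1 + 2 * A ^ 2 * k2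
    simp only [Set.mem_insert_iff, Set.mem_singleton_iff]
    by_cases h0 : (2 * μ - c) ^ 2 - (A * B) ^ 2 = 0
    · rcases sq_eq_sq_iff_eq_or_eq_neg.1 (sub_eq_zero.1 h0) with h | h
      · left; linarith
      · right; left; linarith
    · right; right
      have hx0 := (mul_eq_zero.1 f1).resolve_left h0
      have hy0 := (mul_eq_zero.1 f2).resolve_left h0
      by_contra hm
      apply hv0
      funext i
      have := hvi i
      rw [hx0, hy0] at this
      have h3 : μ * v i = 0 := by linarith
      exact (mul_eq_zero.1 h3).resolve_left hm
  · intro h3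
    have hk : LinearMap.ker (Matrix.of ![a, b]).mulVecLin ≠ ⊥ :=
      LinearMap.ker_ne_bot_of_finrank_lt (by simp; omega)
    obtain ⟨v, hv, hv0⟩ := Submodule.exists_mem_ne_zero_of_ne_bot hk
    have hv' : (Matrix.of ![a, b]).mulVec v = 0 := hv
    have e1 : ∑ j, a j * v j = 0 := congrFun hv' 0
    have e2 : ∑ j, b j * v j = 0 := congrFun hv' 1
    refine Module.End.hasEigenvalue_of_hasEigenvector (x := v) ⟨?_, hv0⟩
    rw [Module.End.mem_eigenspace_iff]
    funext i
    rw [hSv, e1, e2]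
    simp
end

section
/- Let N ≥ 1, a, b ∈ ℝ^N, and x ∈ ℂ^N. Then the Hermitian inner product satisfies ⟨(a ⊗ b)x, x⟩ = (Σ_j b_j x_j)·(conjugate of Σ_i a_i x_i), and its real part obeys the bounds |Re ⟨(a ⊗ b)x, x⟩| ≤ (1/2)(|⟨a,b⟩| + |a||b|)|x|² ≤ |a||b| |x|². -/
theorem cs_aux {N : ℕ} (a b : Fin N → ℝ) :
    |∑ i, a i * b i| ≤ Real.sqrt (∑ i, a i ^ 2) * Real.sqrt (∑ i, b i ^ 2) := by
  rw [← Real.sqrt_mul (Finset.sum_nonneg fun i _ => sq_nonneg _)]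
  exact Real.abs_le_sqrt (Finset.sum_mul_sq_le_sq_mul_sq _ _ _)

theorem buzano_aux {N : ℕ} (a b u : Fin N → ℝ) :
    |(∑ i, b i * u i) * (∑ i, a i * u i)| ≤ (1 / 2) * (|∑ i, a i * b i| +
        Real.sqrt (∑ i, a i ^ 2) * Real.sqrt (∑ i, b i ^ 2)) * (∑ i, u i ^ 2) := by
  have hU : 0 ≤ ∑ i, u i ^ 2 := Finset.sum_nonneg fun i _ => sq_nonneg _
  have h := cs_aux a (fun i => 2 * (∑ j, b j * u j) * u i - (∑ j, u j ^ 2) * b i)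
  generalize hB : ∑ i, b i * u i = B at *
  generalize hUU : ∑ i, u i ^ 2 = U at *
  have h1 : ∑ i, a i * (2 * B * u i - U * b i) =
      2 * B * (∑ i, a i * u i) - U * ∑ i, a i * b i := by
    rw [Finset.mul_sum, Finset.mul_sum, ← Finset.sum_sub_distrib]
    exact Finset.sum_congr rfl fun i _ => by ring
  have h2 : ∑ i, (2 * B * u i - U * b i) ^ 2 = U ^ 2 * ∑ i, b i ^ 2 := by
    have : ∑ i, (2 * B * u i - U * b i) ^ 2 = 4 * B ^ 2 * (∑ i, u i ^ 2)
        - 4 * B * U * (∑ i, b i * u i) + U ^ 2 * ∑ i, b i ^ 2 := by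
      rw [Finset.mul_sum, Finset.mul_sum, Finset.mul_sum, ← Finset.sum_sub_distrib,
        ← Finset.sum_add_distrib]
      exact Finset.sum_congr rfl fun i _ => by ring
    rw [this, hB, hUU]; ring
  rw [h1, h2, Real.sqrt_mul (sq_nonneg U), Real.sqrt_sq hU] at h
  have h3 := mul_le_mul_of_nonneg_left (le_abs_self (∑ i, a i * b i)) hU
  have h4 := mul_le_mul_of_nonneg_left (neg_abs_le (∑ i, a i * b i)) hU
  rw [abs_le] at h ⊢
  constructor <;> linarith [h.1, h.2]

/-- Let `N ≥ 1`, `a, b ∈ ℝ^N`, and `x ∈ ℂ^N`.  With `a ⊗ b` acting on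
`ℂ^N` componentwise and `⟨u, v⟩ = ∑ i, u i * conj (v i)` the Hermitian inner product,
one has `⟨(a ⊗ b) x, x⟩ = (∑ j, b j * x j) * conj (∑ i, a i * x i)`, and
`|Re ⟨(a ⊗ b) x, x⟩| ≤ (1/2)(|⟨a,b⟩| + |a||b|) |x|² ≤ |a||b| |x|²`. -/
theorem rank_one_hermitian_form (N : ℕ) (hN : 1 ≤ N) (a b : Fin N → ℝ) (x : Fin N → ℂ) :
    (∑ i, ((Matrix.vecMulVec a b).map (fun r => (r : ℂ))).mulVec x i * star (x i)) =
      (∑ j, (b j : ℂ) * x j) * star (∑ i, (a i : ℂ) * x i) ∧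
    |(∑ i, ((Matrix.vecMulVec a b).map (fun r => (r : ℂ))).mulVec x i * star (x i)).re| ≤
      (1 / 2) * (|∑ i, a i * b i| +
        Real.sqrt (∑ i, a i ^ 2) * Real.sqrt (∑ i, b i ^ 2)) * (∑ i, ‖x i‖ ^ 2) ∧
    (1 / 2) * (|∑ i, a i * b i| +
        Real.sqrt (∑ i, a i ^ 2) * Real.sqrt (∑ i, b i ^ 2)) * (∑ i, ‖x i‖ ^ 2) ≤
      Real.sqrt (∑ i, a i ^ 2) * Real.sqrt (∑ i, b i ^ 2) * (∑ i, ‖x i‖ ^ 2) := by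
  have key : (∑ i, ((Matrix.vecMulVec a b).map (fun r => (r : ℂ))).mulVec x i * star (x i)) =
      (∑ j, (b j : ℂ) * x j) * star (∑ i, (a i : ℂ) * x i) := by
    rw [star_sum, Finset.mul_sum]
    refine Finset.sum_congr rfl fun i _ => ?_
    simp only [Matrix.mulVec, dotProduct, Matrix.map_apply, Matrix.vecMulVec_apply,
      Finset.sum_mul]
    refine Finset.sum_congr rfl fun j _ => ?_
    simp
    ring
  have hx : ∑ i, ‖x i‖ ^ 2 = ∑ i, (x i).re ^ 2 + ∑ i, (x i).im ^ 2 := by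
    rw [← Finset.sum_add_distrib]
    refine Finset.sum_congr rfl fun i _ => ?_
    rw [Complex.sq_norm, Complex.normSq_apply]; ring
  refine ⟨key, ?_, ?_⟩
  · have hre : ((∑ j, (b j : ℂ) * x j) * star (∑ i, (a i : ℂ) * x i)).re =
        (∑ i, b i * (x i).re) * (∑ i, a i * (x i).re) +
        (∑ i, b i * (x i).im) * (∑ i, a i * (x i).im) := by
      simp [Complex.mul_re, Complex.re_sum, Complex.im_sum]
    rw [key, hre, hx, mul_add]
    exact (abs_add_le _ _).trans (add_le_add (buzano_aux _ _ _) (buzano_aux _ _ _))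
  · have := cs_aux a b
    have h0 : 0 ≤ ∑ i, ‖x i‖ ^ 2 := Finset.sum_nonneg fun i _ => sq_nonneg _
    apply mul_le_mul_of_nonneg_right _ h0
    linarith
end

section
/- For all N ≥ 1 and all a, b ∈ ℝ^N, the operator norm (with respect to the Euclidean norm) of the symmetric matrix S = (1/2)(a ⊗ b + (a ⊗ b)ᵀ) equals (1/2)(|⟨a,b⟩| + |a||b|). -/
theorem aux_gram {E : Type*} [NormedAddCommGroup E] [InnerProductSpace ℝ E] (a b x : E) :
    ‖a‖^2 * (inner ℝ b x)^2 + ‖b‖^2 * (inner ℝ a x)^2 ≤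
      (‖a‖^2 * ‖b‖^2 - (inner ℝ a b)^2) * ‖x‖^2
        + 2 * inner ℝ a b * (inner ℝ a x * inner ℝ b x) := by
  have h := (Matrix.posSemidef_gram ℝ ![a, b, x]).det_nonneg
  rw [Matrix.det_fin_three] at h
  simp only [Matrix.gram_apply, Matrix.cons_val_zero, Matrix.cons_val_one, Matrix.cons_val,
    real_inner_self_eq_norm_sq] at h
  rw [real_inner_comm a b, real_inner_comm a x, real_inner_comm b x] at h
  nlinarith [h]

theorem aux_main {E : Type*} [NormedAddCommGroup E] [InnerProductSpace ℝ E] (a b : E)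
    (T : E →L[ℝ] E)
    (hT : ∀ x, T x = (1 / 2 : ℝ) • ((inner ℝ b x : ℝ) • a + (inner ℝ a x : ℝ) • b))
    (hc : 0 ≤ (inner ℝ a b : ℝ)) :
    ‖T‖ = (1 / 2) * (inner ℝ a b + ‖a‖ * ‖b‖) := by
  have hA := norm_nonneg a
  have hB := norm_nonneg b
  rcases eq_or_lt_of_le (mul_nonneg hA hB) with h0 | hAB
  · have hTz : T = 0 := by
      ext x
      rw [hT]
      rcases mul_eq_zero.1 h0.symm with h | h <;> simp [norm_eq_zero.1 h]
    rcases mul_eq_zero.1 h0.symm with h | h <;> simp [hTz, norm_eq_zero.1 h]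
  apply le_antisymm
  · apply ContinuousLinearMap.opNorm_le_bound _ (by positivity)
    intro x
    refine (pow_le_pow_iff_left₀ (norm_nonneg _) (by positivity) two_ne_zero).1 ?_
    have e : ‖T x‖^2 = (1/4) * (‖a‖^2 * (inner ℝ b x)^2 + ‖b‖^2 * (inner ℝ a x)^2
        + 2 * inner ℝ a b * (inner ℝ a x * inner ℝ b x)) := by
      rw [hT, norm_smul, mul_pow, norm_add_sq_real, norm_smul, norm_smul, real_inner_smul_left,
        real_inner_smul_right, mul_pow, mul_pow]
      simp only [Real.norm_eq_abs, sq_abs]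
      ring
    have g := aux_gram a b x
    have k : 2 * (inner ℝ a x * inner ℝ b x) ≤ (inner ℝ a b + ‖a‖ * ‖b‖) * ‖x‖^2 := by
      have k1 := real_inner_mul_inner_self_le (‖b‖ • a + ‖a‖ • b) x
      rw [real_inner_self_eq_norm_sq, real_inner_self_eq_norm_sq, norm_add_sq_real, norm_smul,
        norm_smul, real_inner_smul_left, real_inner_smul_right, inner_add_left,
        real_inner_smul_left, real_inner_smul_left, norm_norm, norm_norm] at k1
      refine le_of_mul_le_mul_left ?_ hAB
      nlinarith [sq_nonneg (‖b‖ * inner ℝ a x - ‖a‖ * inner ℝ b x)]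
    have k2 := mul_le_mul_of_nonneg_left k hc
    rw [e]
    nlinarith
  · set p := ‖b‖ • a + ‖a‖ • b with hp
    have hTp : T p = ((1 / 2) * (inner ℝ a b + ‖a‖ * ‖b‖) : ℝ) • p := by
      rw [hT, hp]
      simp only [inner_add_right, real_inner_smul_right, real_inner_self_eq_norm_sq,
        real_inner_comm a b]
      module
    have hpos : 0 < ‖p‖ := by
      have : ‖p‖^2 = 2 * (‖a‖ * ‖b‖) * (‖a‖ * ‖b‖ + inner ℝ a b) := by
        rw [hp, norm_add_sq_real, norm_smul, norm_smul, real_inner_smul_left,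
          real_inner_smul_right, norm_norm, norm_norm]
        ring
      have h2 : 0 < ‖p‖^2 := by rw [this]; positivity
      exact lt_of_le_of_ne (norm_nonneg p) (fun h => by rw [← h] at h2; norm_num at h2)
    have h := T.le_opNorm p
    rw [hTp, norm_smul, Real.norm_of_nonneg (by positivity)] at h
    exact le_of_mul_le_mul_right h hpos

/-- For all `N ≥ 1` and all `a, b ∈ ℝ^N`, the operator norm (with respect
to the Euclidean norm) of the symmetric part `S = (1/2)(a ⊗ b + (a ⊗ b)ᵀ)` of the
rank-one matrix `a ⊗ b` equals `(1/2)(|⟨a,b⟩| + |a||b|)`. -/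
theorem opNorm_symmetric_part_rank_one (N : ℕ) (hN : 1 ≤ N) (a b : Fin N → ℝ)
    (S : Matrix (Fin N) (Fin N) ℝ)
    (hS : S = (1 / 2 : ℝ) • (Matrix.vecMulVec a b + (Matrix.vecMulVec a b).transpose)) :
    ‖Matrix.toEuclideanCLM (𝕜 := ℝ) S‖ =
      (1 / 2) * (|∑ i, a i * b i| +
        Real.sqrt (∑ i, a i ^ 2) * Real.sqrt (∑ i, b i ^ 2)) := by
  set T := Matrix.toEuclideanCLM (𝕜 := ℝ) S with hTdef
  set a' : EuclideanSpace ℝ (Fin N) := WithLp.toLp 2 a with ha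
  set b' : EuclideanSpace ℝ (Fin N) := WithLp.toLp 2 b with hb
  have i1 : ∑ i, a i * b i = inner ℝ a' b' := by
    simp [ha, hb, PiLp.inner_apply, mul_comm]
  have i2 : Real.sqrt (∑ i, a i ^ 2) = ‖a'‖ := by
    simp [ha, EuclideanSpace.norm_eq]
  have i3 : Real.sqrt (∑ i, b i ^ 2) = ‖b'‖ := by
    simp [hb, EuclideanSpace.norm_eq]
  have hT : ∀ x, T x = (1 / 2 : ℝ) • ((inner ℝ b' x : ℝ) • a' + (inner ℝ a' x : ℝ) • b') := by
    intro x
    ext i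
    rw [hTdef, Matrix.ofLp_toEuclideanCLM, hS]
    simp only [Matrix.mulVec, dotProduct, Matrix.smul_apply, Matrix.add_apply,
      Matrix.transpose_apply, Matrix.vecMulVec_apply, PiLp.smul_apply, PiLp.add_apply,
      smul_eq_mul, PiLp.inner_apply, ha, hb, Finset.sum_mul, ← Finset.sum_add_distrib,
      Finset.mul_sum]
    refine Finset.sum_congr rfl fun j _ => ?_
    simp
    ring
  rw [i1, i2, i3]
  rcases le_total 0 (inner ℝ a' b' : ℝ) with h | h
  · rw [abs_of_nonneg h]
    exact aux_main a' b' T hT h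
  · rw [abs_of_nonpos h]
    have := aux_main a' (-b') (-T) (by
      intro x
      rw [ContinuousLinearMap.neg_apply, hT, inner_neg_left]
      module) (by rw [inner_neg_right]; linarith)
    rwa [norm_neg, norm_neg, inner_neg_right] at this
end

section
/- Let ξ ∈ (0,∞)^N satisfy the chemical balance condition κ_b ξ^β = κ_f ξ^α, suppose b(ξ) = (b_1(ξ),…,b_N(ξ)) ≠ 0, and suppose there exists φ ∈ ℝ with a_i = φ b_i(ξ) for all i (i.e., the vector a = α − β is a scalar multiple φ of b(ξ)). Then φ ≤ 0. -/
/-- Let `ξ ∈ (0,∞)^N` satisfy the chemical balance condition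
`κ_b ξ^β = κ_f ξ^α`, suppose the vector `b(ξ)` with entries
`b_i(ξ) = κ_b β_i ξ^{β - e_i} - κ_f α_i ξ^{α - e_i}` is nonzero, and suppose there exists
`φ ∈ ℝ` with `a_i = α_i - β_i = φ b_i(ξ)` for all `i`.  Then `φ ≤ 0`. -/
theorem chemical_balance_parallel_nonpositive (N : ℕ) (hN : 1 ≤ N) (α β : Fin N → ℝ)
    (hα : ∀ k, α k = 0 ∨ 1 ≤ α k) (hβ : ∀ k, β k = 0 ∨ 1 ≤ β k)
    (hα0 : α ≠ 0) (hβ0 : β ≠ 0)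
    (κf κb : ℝ) (hκf : 0 < κf) (hκb : 0 < κb)
    (ξ : Fin N → ℝ) (hξ : ∀ i, 0 < ξ i)
    (hbal : κb * ∏ k, ξ k ^ β k = κf * ∏ k, ξ k ^ α k)
    (bvec : Fin N → ℝ)
    (hbvec : ∀ i, bvec i =
      κb * β i * ∏ k, ξ k ^ (β k - if k = i then (1 : ℝ) else 0) -
      κf * α i * ∏ k, ξ k ^ (α k - if k = i then (1 : ℝ) else 0))
    (hbne : bvec ≠ 0)
    (φ : ℝ) (hφ : ∀ i, α i - β i = φ * bvec i) :
    φ ≤ 0 := by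
  have key : ∀ (γ : Fin N → ℝ) (i : Fin N),
      ∏ k, ξ k ^ (γ k - if k = i then (1 : ℝ) else 0) = (∏ k, ξ k ^ γ k) / ξ i := by
    intro γ i
    have h1 : ∀ k, ξ k ^ (γ k - if k = i then (1 : ℝ) else 0)
        = ξ k ^ γ k / (if k = i then ξ k else 1) := by
      intro k
      rw [Real.rpow_sub (hξ k)]
      split_ifs <;> simp
    simp_rw [h1]
    rw [Finset.prod_div_distrib]
    simp
  obtain ⟨i, hi⟩ := Function.ne_iff.mp hbne
  have hP : 0 < ∏ k, ξ k ^ α k := Finset.prod_pos fun k _ => Real.rpow_pos_of_pos (hξ k) _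
  have hx := hξ i
  have hb := hbvec i
  rw [key, key] at hb
  have hC : 0 < κf * (∏ k, ξ k ^ α k) / ξ i := by positivity
  have hb2 : bvec i = -(κf * (∏ k, ξ k ^ α k) / ξ i) * (α i - β i) := by
    have e : κb * β i * ((∏ k, ξ k ^ β k) / ξ i)
        = β i * (κb * ∏ k, ξ k ^ β k) / ξ i := by ring
    rw [hb, e, hbal]
    ring
  generalize κf * (∏ k, ξ k ^ α k) / ξ i = C at hC hb2
  rw [hφ i] at hb2
  have hi' : bvec i ≠ 0 := hi
  have h3 : 1 = -(C * φ) := by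
    apply mul_right_cancel₀ hi'
    linarith
  by_contra h
  push Not at h
  have := mul_pos hC h
  linarith
end
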